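/- Let λ, C ∈ ℂ and let u, W, S : ℝ² → ℂ be smooth functions such that S is nowhere zero, S² = −W_x² + λW² + C everywhere, and W_xx = 2uS + λW, W_t = (λ + 2u²)W_x + 2u_x S hold on ℝ². Then u satisfies the modified Korteweg–de Vries equation u_t = u_xxx + 6u²u_x. (This is the 'only if' direction of the statement that the nonlinear Lax pair for mKdV is compatible exactly on solutions of mKdV, Theorem 3 of the paper.) -/

import Mathlib

open Complex

/-- Partial derivative with respect to the first variable `x`. -/
noncomputable def dX (f : ℝ → ℝ → ℂ) : ℝ → ℝ → ℂ := fun x t => deriv (fun y => f y t) x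

/-- Partial derivative with respect to the second variable `t`. -/
noncomputable def dT (f : ℝ → ℝ → ℂ) : ℝ → ℝ → ℂ := fun x t => deriv (fun s => f x s) t

/-- `f` is a smooth function of `(x,t) ∈ ℝ²`. -/
def Smooth2 (f : ℝ → ℝ → ℂ) : Prop := ContDiff ℝ (⊤ : ℕ∞) (fun p : ℝ × ℝ => f p.1 p.2)

theorem Smooth2.differentiable {f : ℝ → ℝ → ℂ} (hf : Smooth2 f) :
    Differentiable ℝ (fun p : ℝ × ℝ => f p.1 p.2) :=
  ContDiff.differentiable hf (by simp)

theorem Smooth2.hasDerivAt_fst_fderiv {f : ℝ → ℝ → ℂ} (hf : Smooth2 f) (x t : ℝ) :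
    HasDerivAt (fun y => f y t) (fderiv ℝ (fun p : ℝ × ℝ => f p.1 p.2) (x, t) (1, 0)) x :=
  (hf.differentiable (x, t)).hasFDerivAt.comp_hasDerivAt (f := fun y => (y, t)) x
    ((hasDerivAt_id x).prodMk (hasDerivAt_const x t))

theorem Smooth2.hasDerivAt_snd_fderiv {f : ℝ → ℝ → ℂ} (hf : Smooth2 f) (x t : ℝ) :
    HasDerivAt (fun s => f x s) (fderiv ℝ (fun p : ℝ × ℝ => f p.1 p.2) (x, t) (0, 1)) t :=
  (hf.differentiable (x, t)).hasFDerivAt.comp_hasDerivAt (f := fun s => (x, s)) t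
    ((hasDerivAt_const t x).prodMk (hasDerivAt_id t))

theorem Smooth2.dX_eq_fderiv {f : ℝ → ℝ → ℂ} (hf : Smooth2 f) (x t : ℝ) :
    dX f x t = fderiv ℝ (fun p : ℝ × ℝ => f p.1 p.2) (x, t) (1, 0) :=
  (hf.hasDerivAt_fst_fderiv x t).deriv

theorem Smooth2.dT_eq_fderiv {f : ℝ → ℝ → ℂ} (hf : Smooth2 f) (x t : ℝ) :
    dT f x t = fderiv ℝ (fun p : ℝ × ℝ => f p.1 p.2) (x, t) (0, 1) :=
  (hf.hasDerivAt_snd_fderiv x t).deriv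

theorem Smooth2.hasDerivAt_dX {f : ℝ → ℝ → ℂ} (hf : Smooth2 f) (x t : ℝ) :
    HasDerivAt (fun y => f y t) (dX f x t) x :=
  hf.dX_eq_fderiv x t ▸ hf.hasDerivAt_fst_fderiv x t

theorem Smooth2.hasDerivAt_dT {f : ℝ → ℝ → ℂ} (hf : Smooth2 f) (x t : ℝ) :
    HasDerivAt (fun s => f x s) (dT f x t) t :=
  hf.dT_eq_fderiv x t ▸ hf.hasDerivAt_snd_fderiv x t

theorem Smooth2.contDiff_fderiv {f : ℝ → ℝ → ℂ} (hf : Smooth2 f) :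
    ContDiff ℝ (⊤ : ℕ∞) (fderiv ℝ (fun p : ℝ × ℝ => f p.1 p.2)) :=
  ContDiff.fderiv_right hf (by simp)

theorem Smooth2.smooth_dX {f : ℝ → ℝ → ℂ} (hf : Smooth2 f) : Smooth2 (dX f) := by
  simp only [Smooth2, hf.dX_eq_fderiv]
  exact hf.contDiff_fderiv.clm_apply contDiff_const

theorem Smooth2.smooth_dT {f : ℝ → ℝ → ℂ} (hf : Smooth2 f) : Smooth2 (dT f) := by
  simp only [Smooth2, hf.dT_eq_fderiv]
  exact hf.contDiff_fderiv.clm_apply contDiff_const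

/-- Mixed partial derivatives of a smooth function commute. -/
theorem Smooth2.dT_dX {f : ℝ → ℝ → ℂ} (hf : Smooth2 f) (x t : ℝ) :
    dT (dX f) x t = dX (dT f) x t := by
  have hsymm : IsSymmSndFDerivAt ℝ (fun p : ℝ × ℝ => f p.1 p.2) (x, t) :=
    (ContDiff.contDiffAt hf).isSymmSndFDerivAt (by
      rw [minSmoothness_of_isRCLikeNormedField]
      exact WithTop.coe_le_coe.2 le_top)
  have hd := hf.contDiff_fderiv.differentiable (by simp) (x, t)
  rw [hf.smooth_dX.dT_eq_fderiv, hf.smooth_dT.dX_eq_fderiv]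
  simp only [hf.dX_eq_fderiv, hf.dT_eq_fderiv, Prod.mk.eta]
  rw [fderiv_clm_apply hd (by fun_prop), fderiv_clm_apply hd (by fun_prop)]
  simpa using hsymm (0, 1) (1, 0)

/-- If the nonlinear Lax pair `W_xx = 2uS + λW`, `W_t = (λ + 2u²)W_x + 2u_x S`
with `S² = −W_x² + λW² + C` is compatible, then `u` solves the mKdV equation
`u_t = u_xxx + 6u²u_x`. -/
theorem mkdv_nonlinear_lax_pair_implies_mkdv
    (lam C : ℂ) (u W S : ℝ → ℝ → ℂ)
    (hu : Smooth2 u) (hW : Smooth2 W) (hS : Smooth2 S)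
    (hSne : ∀ x t, S x t ≠ 0)
    (hS2 : ∀ x t, (S x t) ^ 2 = -(dX W x t) ^ 2 + lam * (W x t) ^ 2 + C)
    (hWxx : ∀ x t, dX (dX W) x t = 2 * u x t * S x t + lam * W x t)
    (hWt : ∀ x t, dT W x t = (lam + 2 * (u x t) ^ 2) * dX W x t + 2 * dX u x t * S x t) :
    ∀ x t, dT u x t = dX (dX (dX u)) x t + 6 * (u x t) ^ 2 * dX u x t := by
  have hSx : ∀ x t, dX S x t = -2 * u x t * dX W x t := by
    intro x t
    have hl := (hS.hasDerivAt_dX x t).fun_pow 2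
    simp only [hS2] at hl
    have hr := (((hW.smooth_dX.hasDerivAt_dX x t).fun_pow 2).fun_neg.fun_add
      (((hW.hasDerivAt_dX x t).fun_pow 2).const_mul lam)).add_const C
    have h := hl.unique hr
    rw [hWxx] at h
    push_cast at h
    apply mul_left_cancel₀ (hSne x t)
    linear_combination h / 2
  have hVt : ∀ x t, dT (dX W) x t =
      (lam + 2 * u x t ^ 2) * (2 * u x t * S x t + lam * W x t) + 2 * dX (dX u) x t * S x t := by
    intro x t
    have hl := hW.smooth_dT.hasDerivAt_dX x t
    simp only [hWt] at hl
    have hr := ((((hu.hasDerivAt_dX x t).fun_pow 2).const_mul 2).const_add lam |>.fun_mul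
      (hW.smooth_dX.hasDerivAt_dX x t)).fun_add
      (((hu.smooth_dX.hasDerivAt_dX x t).const_mul 2).fun_mul (hS.hasDerivAt_dX x t))
    have h := hl.unique hr
    rw [hWxx, hSx] at h
    push_cast at h
    rw [hW.dT_dX]
    linear_combination h
  have hSt : ∀ x t, dT S x t = -2 * u x t * (lam + 2 * u x t ^ 2) * dX W x t
      - 2 * dX (dX u) x t * dX W x t + 2 * lam * dX u x t * W x t := by
    intro x t
    have hl := (hS.hasDerivAt_dT x t).fun_pow 2
    simp only [hS2] at hl
    have hr := (((hW.smooth_dX.hasDerivAt_dT x t).fun_pow 2).fun_neg.fun_add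
      (((hW.hasDerivAt_dT x t).fun_pow 2).const_mul lam)).add_const C
    have h := hl.unique hr
    rw [hVt, hWt] at h
    push_cast at h
    apply mul_left_cancel₀ (hSne x t)
    linear_combination h / 2
  intro x t
  have hl := hW.smooth_dX.smooth_dX.hasDerivAt_dT x t
  simp only [hWxx] at hl
  have hr := (((hu.hasDerivAt_dT x t).const_mul 2).fun_mul (hS.hasDerivAt_dT x t)).fun_add
    ((hW.hasDerivAt_dT x t).const_mul lam)
  have hWxxt := hl.unique hr
  rw [hSt, hWt] at hWxxt
  have hl' := hW.smooth_dX.smooth_dT.hasDerivAt_dX x t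
  simp only [hVt] at hl'
  have hr' := ((((hu.hasDerivAt_dX x t).fun_pow 2).const_mul 2).const_add lam |>.fun_mul
    ((((hu.hasDerivAt_dX x t).const_mul 2).fun_mul (hS.hasDerivAt_dX x t)).fun_add
      ((hW.hasDerivAt_dX x t).const_mul lam))).fun_add
    (((hu.smooth_dX.smooth_dX.hasDerivAt_dX x t).const_mul 2).fun_mul (hS.hasDerivAt_dX x t))
  have hWxtx := hl'.unique hr'
  rw [hSx] at hWxtx
  push_cast at hWxtx
  have hcomm := hW.smooth_dX.dT_dX x t
  apply mul_left_cancel₀ (hSne x t)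
  linear_combination (hcomm + hWxtx - hWxxt) / 2
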